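/- arXiv:2007.14202 — 2 statements merged into one kernel-verified Lean document; each statement's English description precedes it below -/
import Mathlib

section
/- For integers n1 and n2, the semidirect products Ga ⋊_{(n1)} Gm and Ga ⋊_{(n2)} Gm (where Gm acts on the additive group Ga = (k,+) by x ↦ t^n x) are isomorphic as groups if and only if n1 = ±n2. -/
/-- For `t : kˣ`, the automorphism `x ↦ t^n · x` of the additive group `Ga = (k, +)`,
viewed as a multiplicative automorphism of `Multiplicative k`. -/
def gaGmAut (k : Type*) [Field k] (n : ℤ) (t : kˣ) : MulAut (Multiplicative k) :=
  AddEquiv.toMultiplicative ((DistribMulAction.toAddAut kˣ k) (t ^ n))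

/-- The action homomorphism `Gm →* Aut(Ga)`, `t ↦ (x ↦ t^n x)`. -/
def gaGmHom (k : Type*) [Field k] (n : ℤ) : kˣ →* MulAut (Multiplicative k) where
  toFun := gaGmAut k n
  map_one' := by
    ext x
    simp [gaGmAut]
  map_mul' t s := by
    ext x
    simp [gaGmAut, mul_zpow, mul_smul]

/-- The semidirect product `Ga ⋊_{(n)} Gm`, where `t ∈ Gm = kˣ` acts on `Ga = (k,+)`
by `x ↦ t^n · x`. -/
abbrev GaGm (k : Type*) [Field k] (n : ℤ) : Type _ :=
  Multiplicative k ⋊[gaGmHom k n] kˣ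

theorem gaGm_mul_left (k : Type*) [Field k] (n : ℤ) (a b : GaGm k n) :
    (a * b).left.toAdd = a.left.toAdd + ((a.right ^ n : kˣ) : k) * b.left.toAdd := rfl

theorem gaGm_mem_center (k : Type*) [Field k] [CharZero k] (n : ℤ) (hn : n ≠ 0)
    (a : GaGm k n) :
    a ∈ Subgroup.center (GaGm k n) ↔ a.left = 1 ∧ a.right ^ n = 1 := by
  rw [Subgroup.mem_center_iff]
  constructor
  · intro h
    have key : ∀ (y : k) (s : kˣ), y + ((s ^ n : kˣ) : k) * a.left.toAdd
        = a.left.toAdd + ((a.right ^ n : kˣ) : k) * y := by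
      intro y s
      have h1 := congrArg (fun z : GaGm k n => z.left.toAdd) (h ⟨Multiplicative.ofAdd y, s⟩)
      simpa only [gaGm_mul_left, toAdd_ofAdd] using h1
    have h1 := key 1 1
    have h2 := key 0 (Units.mk0 2 two_ne_zero)
    simp only [one_zpow, Units.val_one, one_mul, mul_one, mul_zero, zero_add, add_zero] at h1 h2
    have h3 : (((Units.mk0 (2 : k) two_ne_zero) ^ n : kˣ) : k) ≠ 1 := by
      rw [Units.val_zpow_eq_zpow_val, Units.val_mk0]
      intro h
      have h4 : ((2 : ℚ) ^ n) = 1 := by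
        have : (((2 : ℚ) ^ n : ℚ) : k) = ((1 : ℚ) : k) := by push_cast; exact h
        exact_mod_cast this
      exact hn ((zpow_eq_one_iff_right₀ (by norm_num) (by norm_num)).1 h4)
    constructor
    · have h5 : a.left.toAdd = 0 := by
        by_contra h6
        exact h3 (mul_right_cancel₀ h6 (h2.trans (one_mul _).symm))
      exact Multiplicative.toAdd.injective h5
    · apply Units.ext
      rw [add_comm] at h1
      exact (add_left_cancel h1).symm
  · rintro ⟨h1, h2⟩ g
    apply SemidirectProduct.ext
    · apply Multiplicative.toAdd.injective
      rw [gaGm_mul_left, gaGm_mul_left, h1, h2]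
      simp
    · simp [mul_comm]

theorem gaGm_card_center (k : Type*) [Field k] [IsAlgClosed k] [CharZero k] (n : ℤ) :
    Nat.card (Subgroup.center (GaGm k n)) = n.natAbs := by
  by_cases hn : n = 0
  · subst hn
    have : Infinite (Subgroup.center (GaGm k 0)) := by
      have hc : ∀ x : k, (SemidirectProduct.inl (Multiplicative.ofAdd x) : GaGm k 0) ∈
          Subgroup.center (GaGm k 0) := by
        intro x
        rw [Subgroup.mem_center_iff]
        intro g
        apply SemidirectProduct.ext
        · apply Multiplicative.toAdd.injective
          rw [gaGm_mul_left, gaGm_mul_left]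
          simp [add_comm]
        · simp
      refine Infinite.of_injective (fun x : k => (⟨_, hc x⟩ : Subgroup.center (GaGm k 0))) ?_
      intro x y h
      have := SemidirectProduct.inl_injective (congrArg Subtype.val h)
      exact Multiplicative.ofAdd.injective this
    simp
  · haveI : NeZero n.natAbs := ⟨Int.natAbs_ne_zero.2 hn⟩
    haveI : NeZero (n.natAbs : k) := ⟨Nat.cast_ne_zero.2 (Int.natAbs_ne_zero.2 hn)⟩
    have hz : ∀ t : kˣ, t ^ n = 1 ↔ t ∈ rootsOfUnity n.natAbs k := by
      intro t
      rw [mem_rootsOfUnity, pow_natAbs_eq_one]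
    rw [← HasEnoughRootsOfUnity.natCard_rootsOfUnity k n.natAbs]
    refine Nat.card_congr
      { toFun := fun a => ⟨a.1.right, (hz _).1 ((gaGm_mem_center k n hn _).1 a.2).2⟩
        invFun := fun t => ⟨⟨1, t.1⟩, (gaGm_mem_center k n hn _).2 ⟨rfl, (hz _).2 t.2⟩⟩
        left_inv := ?_
        right_inv := fun t => rfl }
    intro a
    apply Subtype.ext
    exact SemidirectProduct.ext ((gaGm_mem_center k n hn _).1 a.2).1.symm rfl

/-- for integers `n₁`, `n₂`, the groups `Ga ⋊_{(n₁)} Gm` and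
`Ga ⋊_{(n₂)} Gm` are isomorphic if and only if `n₁ = ± n₂`. -/
theorem stmt_0 (k : Type*) [Field k] [IsAlgClosed k] [CharZero k] (n₁ n₂ : ℤ) :
    Nonempty (GaGm k n₁ ≃* GaGm k n₂) ↔ n₁ = n₂ ∨ n₁ = -n₂ := by
  constructor
  · rintro ⟨e⟩
    have h := Nat.card_congr (Subgroup.centerCongr e).toEquiv
    rw [gaGm_card_center, gaGm_card_center] at h
    exact Int.natAbs_eq_natAbs_iff.1 h
  · rintro (rfl | rfl)
    · exact ⟨MulEquiv.refl _⟩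
    · refine ⟨SemidirectProduct.congr (MulEquiv.refl _) (MulEquiv.inv kˣ) ?_⟩
      intro t
      ext x
      simp [gaGmHom, gaGmAut]
end

section
/- Let X be a Du Val cubic surface in P^3 that contains three lines L_1, L_2, L_3 forming a triangle (meeting pairwise in three distinct points). Then X does not admit an effective action of the additive group Ga. -/
open Matrix MvPolynomial

namespace GaCubic

/-- A polynomial without roots over an algebraically closed field is constant. -/
lemma eval_eq_one {k : Type*} [Field k] [IsAlgClosed k] (p : Polynomial k)
    (h0 : p.eval 0 = 1) (h : ∀ t, p.eval t ≠ 0) (t : k) : p.eval t = 1 := by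
  have hd : p.degree = 0 := by
    by_contra hd
    obtain ⟨x, hx⟩ := IsAlgClosed.exists_root p hd
    exact h x hx
  rw [Polynomial.eq_C_of_degree_eq_zero hd] at h0 ⊢
  simpa using h0

lemma eval_smul_hom {k : Type*} [Field k] (F : MvPolynomial (Fin 4) k)
    (hhom : F.IsHomogeneous 3) (a : k) (v : Fin 4 → k) :
    eval (a • v) F = a ^ 3 * eval v F := by
  rw [eval_eq, eval_eq, Finset.mul_sum]
  refine Finset.sum_congr rfl fun d hd => ?_
  have h3 : ∑ i ∈ d.support, d i = 3 := by
    have := hhom (mem_support_iff.mp hd)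
    rwa [Finsupp.weight_apply, Finsupp.sum, Finset.sum_congr rfl] at this
    intro i _
    simp
  simp only [Pi.smul_apply, smul_eq_mul, mul_pow, Finset.prod_mul_distrib,
    Finset.prod_pow_eq_pow_sum, h3]
  ring

/-- The restriction of `F` to the line `x + s w`, as a polynomial in `s`. -/
lemma exists_line_poly {k : Type*} [Field k] (F : MvPolynomial (Fin 4) k)
    (x w : Fin 4 → k) : ∃ p : Polynomial k, ∀ s, p.eval s = eval (x + s • w) F := by
  refine ⟨aeval (fun i => Polynomial.C (x i) + Polynomial.X * Polynomial.C (w i)) F, fun s => ?_⟩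
  have : (Polynomial.evalRingHom s).comp
      (aeval (fun i => Polynomial.C (x i) + Polynomial.X * Polynomial.C (w i)) :
        MvPolynomial (Fin 4) k →ₐ[k] Polynomial k).toRingHom = eval (x + s • w) := by
    apply MvPolynomial.ringHom_ext
    · intro r; simp
    · intro i; simp; ring
  exact congrArg (fun f => f F) this

lemma line_zero {k : Type*} [Field k] (F : MvPolynomial (Fin 4) k)
    (x w : Fin 4 → k) (h : Set.Infinite {s : k | eval (x + s • w) F = 0}) (s : k) :
    eval (x + s • w) F = 0 := by
  obtain ⟨p, hp⟩ := exists_line_poly F x w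
  have : p = 0 := by
    apply Polynomial.eq_zero_of_infinite_isRoot
    refine h.mono fun s hs => ?_
    simpa [Polynomial.IsRoot, hp] using hs
  rw [← hp, this]; simp

/-- If infinitely many points of `x + s w` are zeros of `F`, the whole span is. -/
lemma span_zero {k : Type*} [Field k] [CharZero k] (F : MvPolynomial (Fin 4) k)
    (hhom : F.IsHomogeneous 3)
    (x w : Fin 4 → k) (h : Set.Infinite {s : k | eval (x + s • w) F = 0}) :
    ∀ v ∈ Submodule.span k {x, w}, eval v F = 0 := by
  have hl := line_zero F x w h
  have hne : ∀ a b : k, a ≠ 0 → eval (a • x + b • w) F = 0 := by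
    intro a b ha
    have : a • x + b • w = a • (x + (b / a) • w) := by
      rw [smul_add, smul_smul, mul_div_cancel₀ _ ha]
    rw [this, eval_smul_hom F hhom, hl, mul_zero]
  intro v hv
  obtain ⟨a, b, rfl⟩ := Submodule.mem_span_pair.mp hv
  have key := line_zero F (b • w) x ?_ a
  · rwa [add_comm] at key
  · refine (Set.infinite_of_finite_compl (s := {0}ᶜ) ?_).mono ?_
    · simp
    · intro s hs
      rw [Set.mem_ofPred_eq, add_comm]
      exact hne s b hs

/-- A linear functional as a polynomial. -/
noncomputable def linPoly {k : Type*} [Field k] (φ : (Fin 4 → k) →ₗ[k] k) :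
    MvPolynomial (Fin 4) k := ∑ i, C (φ (Pi.single i 1)) * X i

lemma eval_linPoly {k : Type*} [Field k] (φ : (Fin 4 → k) →ₗ[k] k) (v : Fin 4 → k) :
    eval v (linPoly φ) = φ v := by
  simp only [linPoly, map_sum, map_mul, eval_C, eval_X]
  conv_rhs => rw [LinearMap.pi_apply_eq_sum_univ φ v]
  refine Finset.sum_congr rfl fun i _ => ?_
  rw [smul_eq_mul, mul_comm]
  congr 2
  ext j
  simp [Pi.single_apply, eq_comm]

lemma not_dvd_linPoly {k : Type*} [Field k] (F : MvPolynomial (Fin 4) k)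
    (hhom : F.IsHomogeneous 3) (hirr : Irreducible F)
    (φ : (Fin 4 → k) →ₗ[k] k) (hφ : φ ≠ 0) : ¬ F ∣ linPoly φ := by
  intro hd
  have hne : linPoly φ ≠ 0 := by
    intro h0
    apply hφ
    ext i
    have := eval_linPoly φ (Pi.single i 1)
    rw [h0] at this
    simpa using this.symm
  have h1 := totalDegree_le_of_dvd_of_isDomain hd hne
  rw [hhom.totalDegree hirr.ne_zero] at h1
  have h2 : (linPoly φ).totalDegree ≤ 1 := by
    have : (linPoly φ).IsHomogeneous 1 := by
      apply IsHomogeneous.sum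
      intro i _
      simpa using (isHomogeneous_C (Fin 4) (φ (Pi.single i 1))).mul (isHomogeneous_X k i)
    exact this.totalDegree_le
  omega

/-- The zero locus of `F` is not covered by a hyperplane and finitely many lines. -/
lemma not_covered {k : Type*} [Field k] [IsAlgClosed k] (F : MvPolynomial (Fin 4) k)
    (hhom : F.IsHomogeneous 3) (hirr : Irreducible F)
    (S : Set (Submodule k (Fin 4 → k))) (hS : S.Finite)
    (hS2 : ∀ W ∈ S, Module.finrank k W = 2) (φ : (Fin 4 → k) →ₗ[k] k) (hφ : φ ≠ 0) :
    ∃ x, eval x F = 0 ∧ φ x ≠ 0 ∧ ∀ W ∈ S, x ∉ W := by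
  by_contra! hcon
  have hf : ∀ W : Submodule k (Fin 4 → k), ∃ f : (Fin 4 → k) →ₗ[k] k,
      W ∈ S → f ≠ 0 ∧ W ≤ LinearMap.ker f := by
    intro W
    by_cases hW : W ∈ S
    · obtain ⟨f, hf⟩ := W.exists_le_ker_of_lt_top (by
        rw [lt_top_iff_ne_top]
        rintro rfl
        have := hS2 _ hW
        simp at this)
      exact ⟨f, fun _ => hf⟩
    · exact ⟨0, fun h => absurd h hW⟩
  choose f hf using hf
  have hp : Prime F := hirr.prime
  have hmem : linPoly φ * ∏ W ∈ hS.toFinset, linPoly (f W) ∈ Ideal.span {F} := by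
    have : (Ideal.span {F}).IsPrime := (Ideal.span_singleton_prime hp.ne_zero).mpr hp
    rw [← IsPrime.vanishingIdeal_zeroLocus (K := k) (Ideal.span {F}), mem_vanishingIdeal_iff]
    intro x hx
    have hx0 : eval x F = 0 := hx F (Ideal.mem_span_singleton_self F)
    change eval x _ = 0
    rw [map_mul, map_prod, eval_linPoly]
    by_cases h : φ x = 0
    · simp [h]
    · obtain ⟨W, hW, hxW⟩ := hcon x hx0 h
      rw [Finset.prod_eq_zero (hS.mem_toFinset.mpr hW), mul_zero]
      rw [eval_linPoly]
      exact (hf W hW).2 hxW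
  rw [Ideal.mem_span_singleton] at hmem
  rcases hp.dvd_or_dvd hmem with h | h
  · exact not_dvd_linPoly F hhom hirr φ hφ h
  · obtain ⟨W, hW, hd⟩ := (hp.dvd_finsetProd_iff _).mp h
    exact not_dvd_linPoly F hhom hirr _ (hf W (hS.mem_toFinset.mp hW)).1 hd

/-- An elation `x ↦ x + φ(x) w` preserving the surface is trivial. -/
lemma elation_trivial {k : Type*} [Field k] [IsAlgClosed k] [CharZero k]
    (F : MvPolynomial (Fin 4) k)
    (hhom : F.IsHomogeneous 3) (hirr : Irreducible F)
    (hfin : Set.Finite {W : Submodule k (Fin 4 → k) |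
      Module.finrank k W = 2 ∧ ∀ v ∈ W, eval v F = 0})
    (φ : (Fin 4 → k) →ₗ[k] k) (hφ : φ ≠ 0) (w : Fin 4 → k) (hw : φ w = 0)
    (hpres : ∀ v, eval v F = 0 → eval (v + φ v • w) F = 0) : w = 0 := by
  by_contra hw0
  obtain ⟨x, hx, hφx, hxW⟩ := not_covered F hhom hirr _ hfin (fun W hW => hW.1) φ hφ
  have hn : ∀ n : ℕ, eval (x + ((n : k) * φ x) • w) F = 0 := by
    intro n
    induction n with
    | zero => simpa using hx
    | succ n ih =>
      have := hpres _ ih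
      simp only [map_add, map_smul, hw, smul_eq_mul, mul_zero, add_zero] at this
      rw [add_assoc, ← add_smul] at this
      have e : ((n + 1 : ℕ) : k) * φ x = n * φ x + φ x := by push_cast; ring
      rw [e]; exact this
  have hinf : Set.Infinite {s : k | eval (x + s • w) F = 0} := by
    refine (Set.infinite_range_of_injective (f := fun n : ℕ => (n : k) * φ x) ?_).mono ?_
    · intro a b hab
      exact Nat.cast_injective (mul_right_cancel₀ hφx hab)
    · rintro _ ⟨n, rfl⟩
      exact hn n
  refine hxW (Submodule.span k {x, w}) ⟨?_, span_zero F hhom x w hinf⟩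
    (Submodule.subset_span (by simp))
  have hli : LinearIndependent k ![x, w] := by
    rw [LinearIndependent.pair_iff]
    intro s t h
    have h1 := congrArg φ h
    simp only [map_add, map_smul, hw, mul_zero, add_zero, map_zero, smul_eq_mul,
      mul_eq_zero, hφx, or_false] at h1
    subst h1
    simpa [hw0] using h
  have := finrank_span_eq_card hli
  rw [Matrix.range_cons, Matrix.range_cons, Matrix.range_empty, Set.union_empty,
    Set.singleton_union] at this
  simpa using this

/-- `Ga` fixes each line, because `k` is divisible and there are finitely many lines. -/
lemma lines_fixed {k : Type*} [Field k] [CharZero k]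
    (S : Set (Submodule k (Fin 4 → k))) (hS : S.Finite)
    (M : k → GL (Fin 4) k) (hone : M 0 = 1)
    (hgrp : ∀ s t : k, ∃ c : kˣ,
      (M (s + t) : Matrix (Fin 4) (Fin 4) k) =
        (c : k) • ((M s * M t : GL (Fin 4) k) : Matrix (Fin 4) (Fin 4) k))
    (hmap : ∀ t, ∀ W ∈ S, W.map (M t : Matrix (Fin 4) (Fin 4) k).mulVecLin ∈ S)
    (t : k) (W : Submodule k (Fin 4 → k)) (hW : W ∈ S) :
    W.map (M t : Matrix (Fin 4) (Fin 4) k).mulVecLin = W := by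
  have : Finite S := hS
  have hinj : ∀ u, Function.Injective (M u : Matrix (Fin 4) (Fin 4) k).mulVecLin := fun u =>
    Matrix.mulVec_injective_of_isUnit (M u).isUnit
  set N := Nat.card (Equiv.Perm S) with hN
  have hNpos : 0 < N := Nat.card_pos
  set u : k := t / N with hu
  let f : S → S := fun V => ⟨_, hmap u V.1 V.2⟩
  have hfi : Function.Injective f := by
    intro V V' h
    exact Subtype.ext (Submodule.map_injective_of_injective (hinj u) (congrArg Subtype.val h))
  let σ : Equiv.Perm S := Equiv.ofBijective f (Finite.injective_iff_bijective.mp hfi)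
  have hσ : σ ^ N = 1 := pow_card_eq_one'
  have hit : ∀ n : ℕ, W.map (M (n * u) : Matrix (Fin 4) (Fin 4) k).mulVecLin
      = ((σ ^ n) ⟨W, hW⟩ : S).1 := by
    intro n
    induction n with
    | zero => simp [hone]
    | succ n ih =>
      obtain ⟨c, hc⟩ := hgrp u (n * u)
      have e : ((n + 1 : ℕ) : k) * u = u + n * u := by push_cast; ring
      rw [e, hc, pow_succ', Equiv.Perm.mul_apply]
      change _ = Submodule.map (M u : Matrix (Fin 4) (Fin 4) k).mulVecLin
        ((σ ^ n) ⟨W, hW⟩ : S).1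
      rw [← ih, ← Submodule.map_comp, ← Matrix.mulVecLin_mul, Units.val_mul,
        show ((c : k) • ((M u : Matrix (Fin 4) (Fin 4) k) * (M (n * u)).val)).mulVecLin
          = (c : k) • ((M u : Matrix (Fin 4) (Fin 4) k) * (M (n * u)).val).mulVecLin by
          ext; simp]
      exact Submodule.map_smul _ _ _ c.ne_zero
  have h := hit N
  rw [hσ, hu, mul_div_cancel₀ _ (Nat.cast_ne_zero.mpr hNpos.ne')] at h
  simpa using h

/-- Fixed points of a polynomial family of matrices are fixed vectors. -/
lemma vec_fixed {k : Type*} [Field k] [IsAlgClosed k]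
    (M : k → GL (Fin 4) k)
    (hpoly : ∃ P : Matrix (Fin 4) (Fin 4) (Polynomial k),
      ∀ (t : k) (i j : Fin 4), (M t : Matrix (Fin 4) (Fin 4) k) i j = (P i j).eval t)
    (hone : M 0 = 1) (e : Fin 4 → k) (he : e ≠ 0)
    (h : ∀ t, ∃ c : k, (M t : Matrix (Fin 4) (Fin 4) k).mulVec e = c • e) (t : k) :
    (M t : Matrix (Fin 4) (Fin 4) k).mulVec e = e := by
  obtain ⟨P, hP⟩ := hpoly
  choose c hc using h
  obtain ⟨a, ha⟩ := Function.ne_iff.mp he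
  simp only [Pi.zero_apply] at ha
  let p : Polynomial k := (∑ j, P a j * Polynomial.C (e j)) * Polynomial.C (e a)⁻¹
  have hp : ∀ t, p.eval t = c t := by
    intro t
    have := congrFun (hc t) a
    simp only [Matrix.mulVec, dotProduct, Pi.smul_apply, smul_eq_mul, hP] at this
    simp only [p, Polynomial.eval_mul, Polynomial.eval_finsetSum, Polynomial.eval_C, this]
    field_simp
  have hc1 : c t = 1 := by
    rw [← hp]
    refine eval_eq_one p ?_ ?_ t
    · rw [hp]
      have := congrFun (hc 0) a
      simp only [hone, Units.val_one, Matrix.one_mulVec, Pi.smul_apply, smul_eq_mul] at this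
      exact (mul_right_cancel₀ ha (by rw [one_mul]; exact this)).symm
    · intro s hs
      rw [hp] at hs
      have h1 := hc s
      rw [hs, zero_smul] at h1
      exact he (Matrix.mulVec_injective_of_isUnit (M s).isUnit (by rw [h1, Matrix.mulVec_zero]))
  rw [hc, hc1, one_smul]

lemma det_one {k : Type*} [Field k] [IsAlgClosed k]
    (M : k → GL (Fin 4) k)
    (hpoly : ∃ P : Matrix (Fin 4) (Fin 4) (Polynomial k),
      ∀ (t : k) (i j : Fin 4), (M t : Matrix (Fin 4) (Fin 4) k) i j = (P i j).eval t)
    (hone : M 0 = 1) (t : k) : (M t : Matrix (Fin 4) (Fin 4) k).det = 1 := by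
  obtain ⟨P, hP⟩ := hpoly
  have hp : ∀ t, P.det.eval t = (M t : Matrix (Fin 4) (Fin 4) k).det := by
    intro t
    rw [← Polynomial.coe_evalRingHom, RingHom.map_det]
    congr 1
    ext i j
    simp [hP]
  rw [← hp]
  refine eval_eq_one _ ?_ ?_ t
  · rw [hp, hone]; simp
  · intro s
    rw [hp]
    exact ((Matrix.isUnit_iff_isUnit_det _).mp (M s).isUnit).ne_zero

/-- Three independent fixed vectors force a determinant one matrix to be an elation. -/
lemma elation_form {k : Type*} [Field k] (A : Matrix (Fin 4) (Fin 4) k) (hdet : A.det = 1)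
    (e : Fin 3 → Fin 4 → k) (he : LinearIndependent k e) (hfix : ∀ i, A.mulVec (e i) = e i) :
    ∃ (φ : (Fin 4 → k) →ₗ[k] k) (w : Fin 4 → k), φ ≠ 0 ∧ φ w = 0 ∧
      ∀ x, A.mulVec x = x + φ x • w := by
  have hH : Module.finrank k (Submodule.span k (Set.range e)) = 3 := by
    simpa using finrank_span_eq_card he
  obtain ⟨φ, hφ, hle⟩ := (Submodule.span k (Set.range e)).exists_le_ker_of_lt_top (by
    rw [lt_top_iff_ne_top]
    intro h
    rw [h] at hH
    simp at hH)
  have hker : Submodule.span k (Set.range e) = LinearMap.ker φ := by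
    apply Submodule.eq_of_le_of_finrank_eq hle
    have := Module.Dual.finrank_ker_add_one_of_ne_zero (f := φ) hφ
    rw [Module.finrank_fin_fun] at this
    omega
  have hfixH : ∀ x, φ x = 0 → A.mulVec x = x := by
    intro x hx
    have hx' : x ∈ Submodule.span k (Set.range e) := by rw [hker]; exact hx
    clear hx
    induction hx' using Submodule.span_induction with
    | mem x h => obtain ⟨i, rfl⟩ := h; exact hfix i
    | zero => simp
    | add x y hx hy h1 h2 =>
      rw [Matrix.mulVec_add, h1, h2]
    | smul a x hx h1 =>
      rw [Matrix.mulVec_smul, h1]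
  obtain ⟨y, hy⟩ := LinearMap.surjective hφ 1
  refine ⟨φ, A.mulVec y - y, hφ, ?_, ?_⟩
  all_goals
    have hform : ∀ x, A.mulVec x = x + φ x • (A.mulVec y - y) := by
      intro x
      have := hfixH (x - φ x • y) (by simp [hy])
      rw [Matrix.mulVec_sub, Matrix.mulVec_smul] at this
      rw [smul_sub]
      linear_combination this
  · set w := A.mulVec y - y with hw
    have hA : A = 1 + replicateCol Unit w * replicateRow Unit (fun j => φ (Pi.single j 1)) := by
      ext i j
      have := congrFun (hform (Pi.single j 1)) i
      rw [Matrix.mulVec_single_one] at this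
      simp only [Matrix.col_apply, Pi.add_apply, Pi.smul_apply, smul_eq_mul] at this
      rw [this, Matrix.add_apply, Matrix.mul_apply]
      simp [Matrix.one_apply, Pi.single_apply, mul_comm]
    rw [hA, det_one_add_replicateCol_mul_replicateRow] at hdet
    have h0 : (fun j => φ (Pi.single j 1)) ⬝ᵥ w = 0 := by simpa using hdet
    rw [← eval_linPoly]
    simpa [linPoly, dotProduct] using h0
  · exact hform

end GaCubic

/-- a Du Val cubic surface `X ⊂ ℙ³` containing three lines forming a
triangle admits no effective action of the additive group `Ga`.

Formalization: `X` is the projective zero locus of an irreducible homogeneous cubic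
`F` in four variables; being Du Val, `X` contains only finitely many lines (lines are
`2`-dimensional linear subspaces of `k⁴` on whose cone `F` vanishes).  The triangle is
given by three such lines `L₀, L₁, L₂` meeting pairwise in three distinct points.
Since `−K_X` is very ample of degree `3`, every automorphism of `X` is induced by
`PGL₄(k)`, so an algebraic `Ga`-action on `X` is a family `M : k → GL₄(k)` with entries
polynomial in `t`, with `M 0 = 1`, which is a homomorphism into `PGL₄(k)` and preserves
the cone over `X`.  The claim: any such action is trivial in `PGL₄(k)`. -/
theorem stmt_12 (k : Type*) [Field k] [IsAlgClosed k] [CharZero k]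
    (F : MvPolynomial (Fin 4) k) (hhom : F.IsHomogeneous 3) (hirr : Irreducible F)
    (hfin : Set.Finite {W : Submodule k (Fin 4 → k) |
      Module.finrank k W = 2 ∧ ∀ v ∈ W, eval v F = 0})
    (L : Fin 3 → Submodule k (Fin 4 → k))
    (hline : ∀ i, Module.finrank k (L i) = 2 ∧ ∀ v ∈ L i, eval v F = 0)
    (hdist : ∀ i j, i ≠ j → L i ≠ L j)
    (htri : ∀ i j, i ≠ j → Module.finrank k ((L i ⊓ L j : Submodule k (Fin 4 → k)) : Submodule k (Fin 4 → k)) = 1)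
    (hvert : ∀ i j l, i ≠ j → j ≠ l → i ≠ l → (L i ⊓ L j : Submodule k (Fin 4 → k)) ≠ L j ⊓ L l)
    (M : k → GL (Fin 4) k)
    (hpoly : ∃ P : Matrix (Fin 4) (Fin 4) (Polynomial k),
      ∀ (t : k) (i j : Fin 4), (M t : Matrix (Fin 4) (Fin 4) k) i j = (P i j).eval t)
    (hone : M 0 = 1)
    (hgrp : ∀ s t : k, ∃ c : kˣ,
      (M (s + t) : Matrix (Fin 4) (Fin 4) k) =
        (c : k) • ((M s * M t : GL (Fin 4) k) : Matrix (Fin 4) (Fin 4) k))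
    (hpres : ∀ (t : k) (v : Fin 4 → k),
      eval ((M t : Matrix (Fin 4) (Fin 4) k).mulVec v) F = 0 ↔ eval v F = 0) :
    ∀ t : k, ∃ c : kˣ, (M t : Matrix (Fin 4) (Fin 4) k) = (c : k) • (1 : Matrix (Fin 4) (Fin 4) k) := by
  have hmap : ∀ t, ∀ W ∈ {W : Submodule k (Fin 4 → k) |
      Module.finrank k W = 2 ∧ ∀ v ∈ W, eval v F = 0},
      W.map (M t : Matrix (Fin 4) (Fin 4) k).mulVecLin ∈ {W : Submodule k (Fin 4 → k) |
      Module.finrank k W = 2 ∧ ∀ v ∈ W, eval v F = 0} := by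
    intro t W hW
    refine ⟨?_, ?_⟩
    · rw [← hW.1]
      exact (Submodule.equivMapOfInjective _
        (Matrix.mulVec_injective_of_isUnit (M t).isUnit) W).finrank_eq.symm
    · rintro _ ⟨v, hv, rfl⟩
      exact (hpres t v).mpr (hW.2 v hv)
  have hL : ∀ t i, (L i).map (M t : Matrix (Fin 4) (Fin 4) k).mulVecLin = L i := fun t i =>
    GaCubic.lines_fixed _ hfin M hone hgrp hmap t (L i) (hline i)
  have hLm : ∀ t i v, v ∈ L i → (M t : Matrix (Fin 4) (Fin 4) k).mulVec v ∈ L i := by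
    intro t i v hv
    rw [← hL t i]
    exact ⟨v, hv, rfl⟩
  -- vertices
  have hv : ∀ i j, i ≠ j → ∃ e : Fin 4 → k, e ≠ 0 ∧ L i ⊓ L j = Submodule.span k {e} ∧
      ∀ t, (M t : Matrix (Fin 4) (Fin 4) k).mulVec e = e := by
    intro i j hij
    obtain ⟨e, he0, he⟩ := finrank_eq_one_iff'.mp (htri i j hij)
    have hspan : L i ⊓ L j = Submodule.span k {e.1} := by
      ext v
      rw [Submodule.mem_span_singleton]
      constructor
      · intro hv
        obtain ⟨c, hc⟩ := he ⟨v, hv⟩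
        exact ⟨c, congrArg Subtype.val hc⟩
      · rintro ⟨c, rfl⟩
        exact Submodule.smul_mem _ _ e.2
    have he0' : e.1 ≠ 0 := fun h => he0 (Subtype.ext h)
    refine ⟨e.1, he0', hspan, GaCubic.vec_fixed M hpoly hone e.1 he0' fun t => ?_⟩
    have : (M t : Matrix (Fin 4) (Fin 4) k).mulVec e.1 ∈ L i ⊓ L j :=
      ⟨hLm t i _ e.2.1, hLm t j _ e.2.2⟩
    obtain ⟨c, hc⟩ := Submodule.mem_span_singleton.mp (hspan.le this)
    exact ⟨c, hc.symm⟩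
  obtain ⟨a, ha0, ha, hafix⟩ := hv 0 1 (by decide)
  obtain ⟨b, hb0, hb, hbfix⟩ := hv 1 2 (by decide)
  obtain ⟨c, hc0, hc, hcfix⟩ := hv 0 2 (by decide)
  have haL : a ∈ L 0 ⊓ L 1 := by rw [ha]; exact Submodule.mem_span_singleton_self a
  have hbL : b ∈ L 1 ⊓ L 2 := by rw [hb]; exact Submodule.mem_span_singleton_self b
  have hcL : c ∈ L 0 ⊓ L 2 := by rw [hc]; exact Submodule.mem_span_singleton_self c
  have heq : ∀ x y : Fin 4 → k, y ≠ 0 → y ∈ Submodule.span k {x} →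
      Submodule.span k {x} = Submodule.span k {y} := by
    intro x y hy0 hy
    obtain ⟨r, rfl⟩ := Submodule.mem_span_singleton.mp hy
    have hr : r ≠ 0 := by rintro rfl; simp at hy0
    exact (Submodule.span_singleton_smul_eq (IsUnit.mk0 r hr) x).symm
  have hli : LinearIndependent k ![c, a, b] := by
    have hab : LinearIndependent k ![a, b] := by
      rw [LinearIndependent.pair_iff' ha0]
      intro r hr
      apply hvert 0 1 2 (by decide) (by decide) (by decide)
      rw [ha, hb]
      exact heq a b hb0 (Submodule.mem_span_singleton.mpr ⟨r, hr⟩)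
    rw [show ![c, a, b] = Fin.cons c ![a, b] from rfl, linearIndependent_finCons]
    refine ⟨hab, fun hmem => ?_⟩
    have hc1 : c ∈ L 1 := by
      refine Submodule.span_le.mpr ?_ hmem
      rintro _ ⟨i, rfl⟩
      fin_cases i
      · exact haL.2
      · exact hbL.1
    apply hvert 1 0 2 (by decide) (by decide) (by decide)
    have hc01 : c ∈ Submodule.span k {a} := by rw [← ha]; exact ⟨hcL.1, hc1⟩
    rw [inf_comm, ha, hc]
    exact heq a c hc0 hc01
  intro t
  obtain ⟨φ, w, hφ, hφw, hform⟩ := GaCubic.elation_form (M t : Matrix (Fin 4) (Fin 4) k)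
    (GaCubic.det_one M hpoly hone t) _ hli (by
      intro i
      fin_cases i
      · exact hcfix t
      · exact hafix t
      · exact hbfix t)
  have hw : w = 0 := GaCubic.elation_trivial F hhom hirr hfin φ hφ w hφw fun v hv => by
    rw [← hform]
    exact (hpres t v).mpr hv
  refine ⟨1, ?_⟩
  rw [Units.val_one, one_smul]
  apply Matrix.ext_of_mulVec_single
  intro i
  rw [hform, hw, smul_zero, add_zero, Matrix.one_mulVec]
end
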